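/- arXiv:2007.05356 — 4 statements merged into one kernel-verified Lean document; each statement's English description precedes it below -/
import Mathlib

section
/- Let γ satisfy hypothesis (H.) and for r ∈ ℝ set Γ_r(t) := γ(2^r t)/γ(2^r). Then for every t ∈ [1/2, 2] the following hold, uniformly in r: (i) e^{-C₃^{(1)}} ≤ Γ_r(t) ≤ e^{C₃^{(1)}}; (ii) C₂^{(1)}/(2 e^{C₃^{(1)}}) ≤ |Γ_r'(t)| ≤ 2 e^{C₃^{(1)}} C₃^{(1)}; (iii) C₂^{(2)}/(4 e^{C₃^{(1)}}) ≤ |Γ_r''(t)| ≤ 4 e^{C₃^{(1)}} C₃^{(2)}; (iv) |Γ_r^{(j)}(t)| ≤ 2^j e^{C₃^{(1)}} C₃^{(j)} for every j with 2 ≤ j ≤ N. -/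
open MeasureTheory Filter ENNReal NNReal

noncomputable section

/-- Hypothesis (H.) on the curve `γ`, with explicit constants `C₁`, `C₂ j` (j = 1, 2) and
`C₃ j` (j = 1, …, N): `γ` is continuous on `ℝ`, `C^N` on `(0, ∞)`, `γ 0 = 0`, `γ` is odd or
even, increasing on `(0, ∞)`, and satisfies the curvature bounds (i), (ii), (iii). -/
def HypH (γ : ℝ → ℝ) (N : ℕ) (C₁ : ℝ) (C₂ C₃ : ℕ → ℝ) : Prop :=
  Continuous γ ∧ ContDiffOn ℝ N γ (Set.Ioi (0:ℝ)) ∧ γ 0 = 0 ∧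
  ((∀ t, γ (-t) = - γ t) ∨ (∀ t, γ (-t) = γ t)) ∧
  StrictMonoOn γ (Set.Ioi (0:ℝ)) ∧
  0 < C₁ ∧ (∀ j, 1 ≤ j → j ≤ 2 → 0 < C₂ j) ∧ (∀ j, 1 ≤ j → j ≤ N → 0 < C₃ j) ∧
  (∀ t : ℝ, 0 < t → C₁ ≤ |deriv (fun s => deriv γ s / iteratedDeriv 2 γ s) t|) ∧
  (∀ j, 1 ≤ j → j ≤ 2 → ∀ t : ℝ, 0 < t → C₂ j ≤ |t ^ j * iteratedDeriv j γ t / γ t|) ∧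
  (∀ j, 1 ≤ j → j ≤ N → ∀ t : ℝ, 0 < t → |t ^ j * iteratedDeriv j γ t / γ t| ≤ C₃ j)

/-- The rescaled curve `Γ_r (t) = γ (2^r t) / γ (2^r)`. -/
def GammaR (γ : ℝ → ℝ) (r t : ℝ) : ℝ := γ ((2:ℝ) ^ r * t) / γ ((2:ℝ) ^ r)

/-- Rescaling the argument multiplies the `j`-th derivative by `a ^ j`, for any function. -/
theorem iteratedDeriv_comp_mul_div (f : ℝ → ℝ) (a b : ℝ) (j : ℕ) :
    iteratedDeriv j (fun t => f (a * t) / b) =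
      fun t => a ^ j * iteratedDeriv j f (a * t) / b := by
  induction j with
  | zero => simp
  | succ j ih =>
    funext t
    rw [iteratedDeriv_succ, ih, deriv_div_const, deriv_const_mul_field,
      deriv_comp_mul_left, iteratedDeriv_succ, smul_eq_mul]
    ring

/-- A continuous function that vanishes at `0` and strictly increases on `(0, ∞)` is positive
there. -/
theorem pos_of_strictMonoOn_Ioi {f : ℝ → ℝ} (hf : Continuous f) (h0 : f 0 = 0)
    (hm : StrictMonoOn f (Set.Ioi 0)) {t : ℝ} (ht : 0 < t) : 0 < f t := by
  have hhalf : f 0 ≤ f (t / 2) :=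
    le_of_tendsto (hf.continuousAt.continuousWithinAt (s := Set.Ioi 0)).tendsto
      (by
        filter_upwards [Ioo_mem_nhdsGT (half_pos ht)] with x hx
        exact (hm hx.1 (half_pos ht) hx.2).le)
  linarith [hm (half_pos ht) ht (half_lt_self ht)]

/-- A bound on the derivative of `log f` in `log t` makes it Lipschitz in `log t`. -/
theorem abs_log_sub_log_le {f : ℝ → ℝ} {C : ℝ} (hd : DifferentiableOn ℝ f (Set.Ioi 0))
    (hpos : ∀ t, 0 < t → 0 < f t) (hC : ∀ t, 0 < t → |t * deriv f t / f t| ≤ C)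
    {s t : ℝ} (hs : 0 < s) (ht : 0 < t) :
    |Real.log (f t) - Real.log (f s)| ≤ C * |Real.log t - Real.log s| := by
  have hder (u : ℝ) : HasDerivAt (fun u => Real.log (f (Real.exp u)))
      (deriv f (Real.exp u) * Real.exp u / f (Real.exp u)) u := by
    have hu := Real.exp_pos u
    exact ((hd.differentiableAt (Ioi_mem_nhds hu)).hasDerivAt.comp u
      (Real.hasDerivAt_exp u)).log (hpos _ hu).ne'
  have := convex_univ.norm_image_sub_le_of_norm_hasDerivWithin_le
    (fun u _ => (hder u).hasDerivWithinAt)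
    (fun u _ => by
      simpa only [Real.norm_eq_abs, mul_comm] using hC _ (Real.exp_pos u))
    (Set.mem_univ (Real.log s)) (Set.mem_univ (Real.log t))
  simpa [Real.exp_log hs, Real.exp_log ht] using this

/-- On the dyadic range `[1/2, 2]` a bound on the logarithmic derivative controls ratios. -/
theorem div_mem_Icc_exp {f : ℝ → ℝ} {C : ℝ} (hd : DifferentiableOn ℝ f (Set.Ioi 0))
    (hpos : ∀ t, 0 < t → 0 < f t) (hC : ∀ t, 0 < t → |t * deriv f t / f t| ≤ C)
    {a t : ℝ} (ha : 0 < a) (ht : t ∈ Set.Icc (1 / 2 : ℝ) 2) :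
    f (a * t) / f a ∈ Set.Icc (Real.exp (-C)) (Real.exp C) := by
  have ht0 : 0 < t := by linarith [ht.1]
  have hC0 : 0 ≤ C := (abs_nonneg _).trans (hC 1 one_pos)
  have hlog : |Real.log t| ≤ 1 := by
    have h2 : Real.log 2 ≤ 1 := by linarith [Real.log_two_lt_d9]
    have hu := Real.log_le_log ht0 ht.2
    have hl := Real.log_le_log (by norm_num) ht.1
    rw [one_div, Real.log_inv] at hl
    exact abs_le.2 ⟨by linarith, by linarith⟩
  have h := abs_log_sub_log_le hd hpos hC ha (mul_pos ha ht0)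
  rw [Real.log_mul ha.ne' ht0.ne', add_sub_cancel_left,
    ← Real.log_div (hpos _ (mul_pos ha ht0)).ne' (hpos _ ha).ne'] at h
  have hq : 0 < f (a * t) / f a := div_pos (hpos _ (mul_pos ha ht0)) (hpos _ ha)
  obtain ⟨hl, hu⟩ := abs_le.1 (h.trans (mul_le_of_le_one_right hC0 hlog))
  exact ⟨(Real.le_log_iff_exp_le hq).1 hl, (Real.log_le_iff_le_exp hq).1 hu⟩

/-- The derivatives of `GammaR γ r` in terms of the scale-invariant quantities of `γ`. -/
theorem abs_iteratedDeriv_GammaR {γ : ℝ → ℝ} (hpos : ∀ t, 0 < t → 0 < γ t) (r : ℝ) (j : ℕ)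
    {t : ℝ} (ht : 0 < t) :
    |iteratedDeriv j (GammaR γ r) t| =
      |((2:ℝ) ^ r * t) ^ j * iteratedDeriv j γ ((2:ℝ) ^ r * t) / γ ((2:ℝ) ^ r * t)| *
        GammaR γ r t / t ^ j := by
  have ha : (0:ℝ) < (2:ℝ) ^ r := by positivity
  have h1 := hpos _ ha
  have h2 := hpos _ (mul_pos ha ht)
  have h3 : 0 < GammaR γ r t / t ^ j := div_pos (div_pos h2 h1) (pow_pos ht j)
  rw [mul_div_assoc, ← abs_of_pos h3, ← abs_mul]
  unfold GammaR
  rw [iteratedDeriv_comp_mul_div, mul_pow]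
  congr 1
  field_simp

/-- **Lemma 2.1 (i)–(iv).** For `γ` satisfying (H.) with `N` sufficiently large and
`Γ_r (t) = γ (2^r t) / γ (2^r)`, the following bounds hold for `t ∈ [1/2, 2]`, uniformly
in `r`. -/
theorem statement10 :
    ∃ N₀ : ℕ, ∀ N : ℕ, N₀ ≤ N →
    ∀ (γ : ℝ → ℝ) (C₁ : ℝ) (C₂ C₃ : ℕ → ℝ), HypH γ N C₁ C₂ C₃ →
    ∀ (r : ℝ) (t : ℝ), t ∈ Set.Icc (1/2 : ℝ) 2 →
      (Real.exp (-(C₃ 1)) ≤ GammaR γ r t ∧ GammaR γ r t ≤ Real.exp (C₃ 1)) ∧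
      (C₂ 1 / (2 * Real.exp (C₃ 1)) ≤ |deriv (GammaR γ r) t| ∧
        |deriv (GammaR γ r) t| ≤ 2 * Real.exp (C₃ 1) * C₃ 1) ∧
      (C₂ 2 / (4 * Real.exp (C₃ 1)) ≤ |iteratedDeriv 2 (GammaR γ r) t| ∧
        |iteratedDeriv 2 (GammaR γ r) t| ≤ 4 * Real.exp (C₃ 1) * C₃ 2) ∧
      (∀ j : ℕ, 2 ≤ j → j ≤ N →
        |iteratedDeriv j (GammaR γ r) t| ≤ 2 ^ j * Real.exp (C₃ 1) * C₃ j) := by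
  refine ⟨2, fun N hN γ C₁ C₂ C₃ h r t ht => ?_⟩
  obtain ⟨hcont, hdiff, h0, -, hmono, -, -, -, -, hlow, hup⟩ := h
  have hpos : ∀ t, 0 < t → 0 < γ t := fun t => pos_of_strictMonoOn_Ioi hcont h0 hmono
  have ht0 : 0 < t := by linarith [ht.1]
  have ha : (0:ℝ) < (2:ℝ) ^ r := by positivity
  have hΓ : GammaR γ r t ∈ Set.Icc (Real.exp (-(C₃ 1))) (Real.exp (C₃ 1)) :=
    div_mem_Icc_exp (hdiff.differentiableOn (by exact_mod_cast (by omega : N ≠ 0))) hpos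
      (fun t ht => by simpa using hup 1 le_rfl (by omega) t ht) ha ht
  have hΓ0 : 0 < GammaR γ r t := (Real.exp_pos _).trans_le hΓ.1
  have upper (j : ℕ) (h1 : 1 ≤ j) (hj : j ≤ N) :
      |iteratedDeriv j (GammaR γ r) t| ≤ 2 ^ j * Real.exp (C₃ 1) * C₃ j := by
    have hinv : (t ^ j)⁻¹ ≤ 2 ^ j := by
      rw [← inv_pow]
      exact pow_le_pow_left₀ (by positivity) ((inv_le_comm₀ ht0 two_pos).2 (by linarith [ht.1])) j
    have hb := hup j h1 hj _ (mul_pos ha ht0)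
    have hC := (abs_nonneg _).trans hb
    rw [abs_iteratedDeriv_GammaR hpos r j ht0, div_eq_mul_inv]
    calc _ ≤ C₃ j * Real.exp (C₃ 1) * 2 ^ j := by
          gcongr
          exact hΓ.2
      _ = _ := by ring
  have lower (j : ℕ) (h1 : 1 ≤ j) (hj : j ≤ 2) :
      C₂ j / (2 ^ j * Real.exp (C₃ 1)) ≤ |iteratedDeriv j (GammaR γ r) t| := by
    have hb := hlow j h1 hj _ (mul_pos ha ht0)
    rw [abs_iteratedDeriv_GammaR hpos r j ht0]
    calc C₂ j / (2 ^ j * Real.exp (C₃ 1)) = C₂ j * Real.exp (-(C₃ 1)) / 2 ^ j := by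
          rw [Real.exp_neg]
          field_simp
      _ ≤ _ := by
          gcongr
          · exact hΓ.1
          · exact ht.2
  refine ⟨hΓ, ?_, ?_, fun j h2 => upper j (by omega)⟩
  · simpa using And.intro (lower 1 le_rfl one_le_two) (upper 1 le_rfl (by omega))
  · have := And.intro (lower 2 one_le_two le_rfl) (upper 2 one_le_two hN)
    norm_num at this
    exact this

end
end

section
/- Let γ satisfy hypothesis (H.) and for r ∈ ℝ set Γ_r(t) := γ(2^r t)/γ(2^r). Then γ' is strictly monotone on (0,∞) with γ'((0,∞)) = (0,∞), so Γ_r' has an inverse function (Γ_r')^{-1} on (0,∞), and there is a constant C > 0, independent of r, such that |((Γ_r')^{-1})^{(k)}(s)| ≤ C for every integer k with 0 ≤ k < N and every s in the image Γ_r'([1/2,2]). -/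
open MeasureTheory Filter ENNReal NNReal

noncomputable section

/-- The functions `u i` are `m` times differentiable on `U`, and their derivatives of order at most
`m` are bounded on `K` uniformly in `i`. -/
def UniformDerivBound {ι : Type*} (U K : Set ℝ) : ℕ → (ι → ℝ → ℝ) → Prop
  | 0, u => ∃ C, ∀ i, ∀ t ∈ K, |u i t| ≤ C
  | m + 1, u => (∃ C, ∀ i, ∀ t ∈ K, |u i t| ≤ C) ∧ (∀ i, DifferentiableOn ℝ (u i) U) ∧
      UniformDerivBound U K m (fun i => deriv (u i))

namespace UniformDerivBound

variable {ι : Type*} {U K : Set ℝ} {m : ℕ} {u v : ι → ℝ → ℝ}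

theorem exists_bound (h : UniformDerivBound U K m u) : ∃ C, ∀ i, ∀ t ∈ K, |u i t| ≤ C := by
  cases m with
  | zero => exact h
  | succ m => exact h.1

theorem of_succ (h : UniformDerivBound U K (m + 1) u) : UniformDerivBound U K m u := by
  induction m generalizing u with
  | zero => exact h.1
  | succ m ih => exact ⟨h.1, h.2.1, ih h.2.2⟩

theorem of_le {n : ℕ} (h : UniformDerivBound U K n u) (hmn : m ≤ n) :
    UniformDerivBound U K m u := by
  induction n, hmn using Nat.le_induction with
  | base => exact h
  | succ n _ ih => exact ih h.of_succ

theorem congr (hU : IsOpen U) (hK : K ⊆ U) (h : UniformDerivBound U K m u)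
    (huv : ∀ i, Set.EqOn (v i) (u i) U) : UniformDerivBound U K m v := by
  have bound : ∃ C, ∀ i, ∀ t ∈ K, |v i t| ≤ C := by
    obtain ⟨C, hC⟩ := h.exists_bound
    exact ⟨C, fun i t ht => by rw [huv i (hK ht)]; exact hC i t ht⟩
  induction m generalizing u v with
  | zero => exact bound
  | succ m ih =>
    have huv' (i : ι) : Set.EqOn (deriv (v i)) (deriv (u i)) U := (huv i).deriv hU
    refine ⟨bound, fun i => (h.2.1 i).congr (huv i), ih h.2.2 huv' ?_⟩
    obtain ⟨C, hC⟩ := h.2.2.exists_bound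
    exact ⟨C, fun i t ht => by rw [huv' i (hK ht)]; exact hC i t ht⟩

theorem add (hU : IsOpen U) (hK : K ⊆ U) (hu : UniformDerivBound U K m u)
    (hv : UniformDerivBound U K m v) : UniformDerivBound U K m (fun i t => u i t + v i t) := by
  have bound {p : ℕ} {u v : ι → ℝ → ℝ} (hu : UniformDerivBound U K p u)
      (hv : UniformDerivBound U K p v) : ∃ C, ∀ i, ∀ t ∈ K, |u i t + v i t| ≤ C := by
    obtain ⟨C, hC⟩ := hu.exists_bound
    obtain ⟨D, hD⟩ := hv.exists_bound
    exact ⟨C + D, fun i t ht => (abs_add_le _ _).trans (add_le_add (hC i t ht) (hD i t ht))⟩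
  induction m generalizing u v with
  | zero => exact bound hu hv
  | succ m ih =>
    refine ⟨bound hu hv, fun i => (hu.2.1 i).add (hv.2.1 i),
      (ih hu.2.2 hv.2.2).congr hU hK fun i t ht => ?_⟩
    exact deriv_fun_add ((hu.2.1 i).differentiableAt (hU.mem_nhds ht))
      ((hv.2.1 i).differentiableAt (hU.mem_nhds ht))

theorem mul (hU : IsOpen U) (hK : K ⊆ U) (hu : UniformDerivBound U K m u)
    (hv : UniformDerivBound U K m v) : UniformDerivBound U K m (fun i t => u i t * v i t) := by
  have bound {p : ℕ} {u v : ι → ℝ → ℝ} (hu : UniformDerivBound U K p u)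
      (hv : UniformDerivBound U K p v) : ∃ C, ∀ i, ∀ t ∈ K, |u i t * v i t| ≤ C := by
    obtain ⟨C, hC⟩ := hu.exists_bound
    obtain ⟨D, hD⟩ := hv.exists_bound
    refine ⟨C * D, fun i t ht => ?_⟩
    rw [abs_mul]
    exact mul_le_mul (hC i t ht) (hD i t ht) (abs_nonneg _) ((abs_nonneg _).trans (hC i t ht))
  induction m generalizing u v with
  | zero => exact bound hu hv
  | succ m ih =>
    refine ⟨bound hu hv, fun i => (hu.2.1 i).mul (hv.2.1 i),
      ((ih hu.2.2 hv.of_succ).add hU hK (ih hu.of_succ hv.2.2)).congr hU hK fun i t ht => ?_⟩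
    exact deriv_fun_mul ((hu.2.1 i).differentiableAt (hU.mem_nhds ht))
      ((hv.2.1 i).differentiableAt (hU.mem_nhds ht))

theorem neg (h : UniformDerivBound U K m u) : UniformDerivBound U K m (fun i t => -u i t) := by
  induction m generalizing u with
  | zero => simpa [UniformDerivBound] using h
  | succ m ih =>
    refine ⟨by simpa using h.1, fun i => (h.2.1 i).neg, ?_⟩
    simpa only [deriv.fun_neg'] using ih h.2.2

theorem inv (hU : IsOpen U) (hK : K ⊆ U) (h : UniformDerivBound U K m u)
    (h0 : ∀ i, ∀ t ∈ U, u i t ≠ 0) {c : ℝ} (hc : 0 < c) (hcu : ∀ i, ∀ t ∈ K, c ≤ |u i t|) :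
    UniformDerivBound U K m (fun i t => (u i t)⁻¹) := by
  have bound : ∃ C, ∀ i, ∀ t ∈ K, |(u i t)⁻¹| ≤ C :=
    ⟨c⁻¹, fun i t ht => by rw [abs_inv]; exact inv_anti₀ hc (hcu i t ht)⟩
  induction m with
  | zero => exact bound
  | succ m ih =>
    have hi := ih h.of_succ
    refine ⟨bound, fun i => (h.2.1 i).inv (h0 i),
      (h.2.2.neg.mul hU hK (hi.mul hU hK hi)).congr hU hK fun i t ht => ?_⟩
    have hder := ((h.2.1 i).differentiableAt (hU.mem_nhds ht)).hasDerivAt.fun_inv (h0 i t ht)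
    simp only [hder.deriv]
    field_simp

theorem const (c : ℝ) : UniformDerivBound U K m (fun (_ : ι) _ => c) := by
  induction m generalizing c with
  | zero => exact ⟨|c|, fun _ _ _ => le_rfl⟩
  | succ m ih =>
    refine ⟨⟨|c|, fun _ _ _ => le_rfl⟩, fun _ => differentiableOn_const c, ?_⟩
    simpa using ih 0

theorem id (hK : Bornology.IsBounded K) : UniformDerivBound U K m (fun (_ : ι) t => t) := by
  have bound : ∃ C, ∀ _ : ι, ∀ t ∈ K, |t| ≤ C := by
    obtain ⟨C, hC⟩ := hK.exists_norm_le
    exact ⟨C, fun _ t ht => hC t ht⟩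
  cases m with
  | zero => exact bound
  | succ m =>
    refine ⟨bound, fun _ => differentiableOn_id, ?_⟩
    simpa using const 1

end UniformDerivBound

/-- `inverseDerivSeq F k` is the `k`-th derivative of the inverse of `F`, precomposed with `F`. -/
def inverseDerivSeq (F : ℝ → ℝ) : ℕ → ℝ → ℝ
  | 0 => fun t => t
  | k + 1 => fun t => deriv (inverseDerivSeq F k) t * (deriv F t)⁻¹

theorem iteratedDeriv_leftInvOn {U : Set ℝ} (hU : IsOpen U) {F g : ℝ → ℝ}
    (hF : ∀ t ∈ U, HasStrictDerivAt F (deriv F t) t) (hF0 : ∀ t ∈ U, deriv F t ≠ 0)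
    (hg : Set.LeftInvOn g F U) {n : ℕ}
    (hd : ∀ k < n, DifferentiableOn ℝ (inverseDerivSeq F k) U) {k : ℕ} (hk : k ≤ n) :
    ∀ t ∈ U, iteratedDeriv k g (F t) = inverseDerivSeq F k t := by
  induction k with
  | zero => exact fun t ht => by simpa [inverseDerivSeq] using hg ht
  | succ k ih =>
    intro t ht
    have hgd : HasDerivAt g (deriv F t)⁻¹ (F t) :=
      ((hF t ht).to_local_left_inverse (hF0 t ht)
        (Filter.eventually_of_mem (hU.mem_nhds ht) fun x hx => hg hx)).hasDerivAt
    have heq : iteratedDeriv k g =ᶠ[nhds (F t)] inverseDerivSeq F k ∘ g := by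
      rw [← (hF t ht).map_nhds_eq (hF0 t ht)]
      exact Filter.eventually_map.2 (Filter.eventually_of_mem (hU.mem_nhds ht) fun x hx => by
        rw [ih (by omega) x hx, Function.comp_apply, hg hx])
    have hGd : HasDerivAt (inverseDerivSeq F k) (deriv (inverseDerivSeq F k) t) (g (F t)) := by
      rw [hg ht]
      exact ((hd k (by omega)).differentiableAt (hU.mem_nhds ht)).hasDerivAt
    rw [iteratedDeriv_succ, heq.deriv_eq, (hGd.comp (F t) hgd).deriv]
    rfl

theorem UniformDerivBound.inverseDerivSeq {ι : Type*} {U K : Set ℝ} (hU : IsOpen U) (hKU : K ⊆ U)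
    (hK : Bornology.IsBounded K) {F : ι → ℝ → ℝ} {n : ℕ}
    (h : UniformDerivBound U K n (fun i t => (deriv (F i) t)⁻¹)) {k m : ℕ}
    (hkm : k + m = n + 1) : UniformDerivBound U K m (fun i => inverseDerivSeq (F i) k) := by
  induction k generalizing m with
  | zero => exact UniformDerivBound.id hK
  | succ k ih => exact (ih (m := m + 1) (by omega)).2.2.mul hU hKU (h.of_le (by omega))

theorem mul_rpow_le_of_mul_le_deriv {f : ℝ → ℝ} (hf : ∀ t, 0 < t → 0 < f t)
    (hd : DifferentiableOn ℝ f (Set.Ioi 0)) {a : ℝ} (h : ∀ t, 0 < t → a * f t ≤ t * deriv f t)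
    {x y : ℝ} (hx : 0 < x) (hxy : x ≤ y) : f x * (y / x) ^ a ≤ f y := by
  have hy : 0 < y := hx.trans_le hxy
  have hder (t : ℝ) (ht : 0 < t) :
      HasDerivAt (fun t => Real.log (f t) - a * Real.log t) (deriv f t / f t - a * t⁻¹) t :=
    ((hd.differentiableAt (Ioi_mem_nhds ht)).hasDerivAt.log (hf t ht).ne').sub
      ((Real.hasDerivAt_log ht.ne').const_mul a)
  have hmono : MonotoneOn (fun t => Real.log (f t) - a * Real.log t) (Set.Ioi 0) := by
    refine monotoneOn_of_deriv_nonneg (convex_Ioi 0)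
      (fun t ht => (hder t ht).continuousAt.continuousWithinAt) ?_ ?_
    all_goals rw [interior_Ioi]
    · exact fun t ht => (hder t ht).differentiableAt.differentiableWithinAt
    · intro t ht
      have ht : 0 < t := ht
      rw [(hder t ht).deriv, sub_nonneg, ← div_eq_mul_inv, div_le_div_iff₀ ht (hf t ht)]
      linarith [h t ht]
  have hlog : Real.log (f x) - a * Real.log x ≤ Real.log (f y) - a * Real.log y :=
    hmono hx hy hxy
  have hpow : 0 < (y / x) ^ a := Real.rpow_pos_of_pos (div_pos hy hx) a
  rw [← Real.log_le_log_iff (mul_pos (hf x hx) hpow) (hf y hy),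
    Real.log_mul (hf x hx).ne' hpow.ne', Real.log_rpow (div_pos hy hx),
    Real.log_div hy.ne' hx.ne']
  linarith

theorem image_Ioi_of_mul_le_deriv {f : ℝ → ℝ} (hf : ∀ t, 0 < t → 0 < f t)
    (hd : DifferentiableOn ℝ f (Set.Ioi 0)) {a : ℝ} (ha : 0 < a)
    (h : ∀ t, 0 < t → a * f t ≤ t * deriv f t) :
    StrictMonoOn f (Set.Ioi 0) ∧ f '' Set.Ioi 0 = Set.Ioi 0 := by
  refine ⟨fun x hx y hy hxy => ?_, Set.Subset.antisymm ?_ fun c hc => ?_⟩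
  · refine lt_of_lt_of_le ?_ (mul_rpow_le_of_mul_le_deriv hf hd h hx hxy.le)
    exact lt_mul_of_one_lt_right (hf x hx)
      (Real.one_lt_rpow ((one_lt_div (Set.mem_Ioi.1 hx)).2 hxy) ha)
  · rintro _ ⟨t, ht, rfl⟩
    exact hf t ht
  · have hc : 0 < c := hc
    have h1 := hf 1 one_pos
    obtain ⟨y, hy1, hy⟩ := ((Filter.eventually_ge_atTop (1 : ℝ)).and
      ((_root_.tendsto_rpow_atTop ha).eventually_ge_atTop (max (c / f 1) (f 1 / c)))).exists
    have hy0 : 0 < y := one_pos.trans_le hy1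
    have hup : c ≤ f y := by
      have hle := mul_rpow_le_of_mul_le_deriv hf hd h one_pos hy1
      rw [div_one] at hle
      exact ((div_le_iff₀' h1).1 ((le_max_left _ _).trans hy)).trans hle
    have hlow : f y⁻¹ ≤ c := by
      have hle := mul_rpow_le_of_mul_le_deriv hf hd h (inv_pos.2 hy0) (inv_le_one_of_one_le₀ hy1)
      rw [one_div, inv_inv] at hle
      exact le_of_mul_le_mul_right (hle.trans ((div_le_iff₀' hc).1 ((le_max_right _ _).trans hy)))
        (Real.rpow_pos_of_pos hy0 a)
    have hsub : Set.Icc y⁻¹ y ⊆ Set.Ioi 0 := fun t ht => (inv_pos.2 hy0).trans_le ht.1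
    obtain ⟨t, ht, hft⟩ := intermediate_value_Icc ((inv_le_one_of_one_le₀ hy1).trans hy1)
      (hd.continuousOn.mono hsub) ⟨hlow, hup⟩
    exact ⟨t, hsub ht, hft⟩

theorem ContDiffOn.hasDerivAt_iteratedDeriv {f : ℝ → ℝ} {U : Set ℝ} {n j : ℕ}
    (hf : ContDiffOn ℝ n f U) (hU : IsOpen U) (hj : j < n) {t : ℝ} (ht : t ∈ U) :
    HasDerivAt (iteratedDeriv j f) (iteratedDeriv (j + 1) f t) t := by
  have hd := (hf.differentiableOn_iteratedDerivWithin (by exact_mod_cast hj)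
    hU.uniqueDiffOn).congr fun x hx => (iteratedDerivWithin_of_isOpen hU hx).symm
  rw [iteratedDeriv_succ]
  exact (hd.differentiableAt (hU.mem_nhds ht)).hasDerivAt

theorem deriv_GammaR (γ : ℝ → ℝ) (r : ℝ) :
    deriv (GammaR γ r) = fun t => (2 : ℝ) ^ r * deriv γ (2 ^ r * t) / γ (2 ^ r) := by
  funext t
  unfold GammaR
  rw [deriv_div_const, deriv_comp_mul_left, smul_eq_mul]

namespace HypH

variable {γ : ℝ → ℝ} {N : ℕ} {C₁ : ℝ} {C₂ C₃ : ℕ → ℝ}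

theorem pos (h : HypH γ N C₁ C₂ C₃) {t : ℝ} (ht : 0 < t) : 0 < γ t := by
  obtain ⟨hc, -, h0, -, hm, -⟩ := h
  have hge (s : ℝ) (hs : 0 < s) : 0 ≤ γ s := by
    have hlim : Filter.Tendsto γ (nhdsWithin 0 (Set.Ioi 0)) (nhds 0) := by
      simpa only [h0] using (hc.tendsto 0).mono_left nhdsWithin_le_nhds
    refine le_of_tendsto hlim ?_
    filter_upwards [Ioo_mem_nhdsGT hs] with x hx
    exact (hm hx.1 hs hx.2).le
  exact (hge (t / 2) (half_pos ht)).trans_lt (hm (half_pos ht) ht (half_lt_self ht))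

theorem hasDerivAt (h : HypH γ N C₁ C₂ C₃) {j : ℕ} (hj : j < N) {t : ℝ} (ht : 0 < t) :
    HasDerivAt (iteratedDeriv j γ) (iteratedDeriv (j + 1) γ t) t :=
  h.2.1.hasDerivAt_iteratedDeriv isOpen_Ioi hj ht

theorem C₂_pos (h : HypH γ N C₁ C₂ C₃) {j : ℕ} (h1 : 1 ≤ j) (h2 : j ≤ 2) : 0 < C₂ j :=
  h.2.2.2.2.2.2.1 j h1 h2

theorem C₃_pos (h : HypH γ N C₁ C₂ C₃) {j : ℕ} (h1 : 1 ≤ j) (h2 : j ≤ N) : 0 < C₃ j :=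
  h.2.2.2.2.2.2.2.1 j h1 h2

theorem mul_le_abs (h : HypH γ N C₁ C₂ C₃) {j : ℕ} (h1 : 1 ≤ j) (h2 : j ≤ 2) {t : ℝ}
    (ht : 0 < t) : C₂ j * γ t ≤ t ^ j * |iteratedDeriv j γ t| := by
  have := h.2.2.2.2.2.2.2.2.2.1 j h1 h2 t ht
  rwa [abs_div, abs_mul, abs_of_pos (h.pos ht), abs_of_pos (pow_pos ht j),
    le_div_iff₀ (h.pos ht)] at this

theorem abs_le_mul (h : HypH γ N C₁ C₂ C₃) {j : ℕ} (h1 : 1 ≤ j) (h2 : j ≤ N) {t : ℝ}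
    (ht : 0 < t) : t ^ j * |iteratedDeriv j γ t| ≤ C₃ j * γ t := by
  have := h.2.2.2.2.2.2.2.2.2.2 j h1 h2 t ht
  rwa [abs_div, abs_mul, abs_of_pos (h.pos ht), abs_of_pos (pow_pos ht j),
    div_le_iff₀ (h.pos ht)] at this

theorem iteratedDeriv_ne_zero (h : HypH γ N C₁ C₂ C₃) {j : ℕ} (h1 : 1 ≤ j) (h2 : j ≤ 2) {t : ℝ}
    (ht : 0 < t) : iteratedDeriv j γ t ≠ 0 := by
  intro h0
  have := h.mul_le_abs h1 h2 ht
  rw [h0, abs_zero, mul_zero] at this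
  exact this.not_gt (mul_pos (h.C₂_pos h1 h2) (h.pos ht))

theorem deriv_pos (h : HypH γ N C₁ C₂ C₃) {t : ℝ} (ht : 0 < t) : 0 < deriv γ t := by
  refine lt_of_le_of_ne ?_ (Ne.symm ?_)
  · rw [← derivWithin_of_isOpen isOpen_Ioi (Set.mem_Ioi.2 ht)]
    exact h.2.2.2.2.1.monotoneOn.derivWithin_nonneg
  · simpa using h.iteratedDeriv_ne_zero le_rfl one_le_two ht

theorem mul_deriv_le (h : HypH γ N C₁ C₂ C₃) (hN : 1 ≤ N) {t : ℝ} (ht : 0 < t) :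
    t * deriv γ t ≤ C₃ 1 * γ t := by
  simpa [abs_of_pos (h.deriv_pos ht)] using h.abs_le_mul le_rfl hN ht

theorem hasDerivAt_deriv (h : HypH γ N C₁ C₂ C₃) (hN : 2 ≤ N) {t : ℝ} (ht : 0 < t) :
    HasDerivAt (deriv γ) (iteratedDeriv 2 γ t) t := by
  simpa using h.hasDerivAt (j := 1) hN ht

theorem mul_deriv_le_abs_iteratedDeriv_two (h : HypH γ N C₁ C₂ C₃) (hN : 2 ≤ N) {t : ℝ}
    (ht : 0 < t) : C₂ 2 / C₃ 1 * deriv γ t ≤ t * |iteratedDeriv 2 γ t| := by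
  have h3 := h.C₃_pos (j := 1) le_rfl (by omega)
  rw [div_mul_eq_mul_div, div_le_iff₀ h3]
  refine le_of_mul_le_mul_left ?_ ht
  calc t * (C₂ 2 * deriv γ t) = C₂ 2 * (t * deriv γ t) := by ring
    _ ≤ C₂ 2 * (C₃ 1 * γ t) := mul_le_mul_of_nonneg_left (h.mul_deriv_le (by omega) ht)
      (h.C₂_pos one_le_two le_rfl).le
    _ = C₃ 1 * (C₂ 2 * γ t) := by ring
    _ ≤ C₃ 1 * (t ^ 2 * |iteratedDeriv 2 γ t|) :=
      mul_le_mul_of_nonneg_left (h.mul_le_abs one_le_two le_rfl ht) h3.le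
    _ = t * (t * |iteratedDeriv 2 γ t| * C₃ 1) := by ring

theorem strictMonoOn_or_strictAntiOn_and_image (h : HypH γ N C₁ C₂ C₃) (hN : 2 ≤ N) :
    (StrictMonoOn (deriv γ) (Set.Ioi 0) ∨ StrictAntiOn (deriv γ) (Set.Ioi 0)) ∧
      deriv γ '' Set.Ioi 0 = Set.Ioi 0 := by
  have ha : 0 < C₂ 2 / C₃ 1 :=
    div_pos (h.C₂_pos one_le_two le_rfl) (h.C₃_pos le_rfl (by omega))
  rcases hasDerivWithinAt_forall_lt_or_forall_gt_of_forall_ne (convex_Ioi (0 : ℝ))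
    (fun x hx => (h.hasDerivAt_deriv hN hx).hasDerivWithinAt)
    (fun x hx => h.iteratedDeriv_ne_zero one_le_two le_rfl hx) with hneg | hpos
  · have hder (t : ℝ) (ht : 0 < t) : HasDerivAt (fun s => (deriv γ s)⁻¹)
        (-iteratedDeriv 2 γ t / deriv γ t ^ 2) t :=
      (h.hasDerivAt_deriv hN ht).fun_inv (h.deriv_pos ht).ne'
    obtain ⟨hm, hi⟩ := image_Ioi_of_mul_le_deriv (fun t ht => inv_pos.2 (h.deriv_pos ht))
      (fun t ht => (hder t ht).differentiableAt.differentiableWithinAt) ha (fun t ht => by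
        have hp := h.deriv_pos ht
        have hle := h.mul_deriv_le_abs_iteratedDeriv_two hN ht
        rw [abs_of_neg (hneg t ht)] at hle
        rw [(hder t ht).deriv, ← mul_div_assoc, le_div_iff₀ (by positivity)]
        refine le_trans (le_of_eq ?_) hle
        field_simp)
    refine ⟨Or.inr fun x hx y hy hxy => ?_, Set.Subset.antisymm ?_ fun c hc => ?_⟩
    · exact (inv_lt_inv₀ (h.deriv_pos hx) (h.deriv_pos hy)).1 (hm hx hy hxy)
    · rintro _ ⟨t, ht, rfl⟩
      exact h.deriv_pos ht
    · obtain ⟨t, ht, htc⟩ := hi.symm.subset (Set.mem_Ioi.2 (inv_pos.2 (Set.mem_Ioi.1 hc)))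
      exact ⟨t, ht, inv_injective htc⟩
  · obtain ⟨hm, hi⟩ := image_Ioi_of_mul_le_deriv (fun t ht => h.deriv_pos ht)
      (fun t ht => (h.hasDerivAt_deriv hN ht).differentiableAt.differentiableWithinAt) ha
      (fun t ht => by
        have hle := h.mul_deriv_le_abs_iteratedDeriv_two hN ht
        rwa [abs_of_pos (hpos t ht), ← (h.hasDerivAt_deriv hN ht).deriv] at hle)
    exact ⟨Or.inl hm, hi⟩

theorem le_rpow_mul (h : HypH γ N C₁ C₂ C₃) (hN : 1 ≤ N) {x y : ℝ} (hx : 0 < x) (hxy : x ≤ y) :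
    γ y ≤ (y / x) ^ C₃ 1 * γ x := by
  have hy : 0 < y := hx.trans_le hxy
  have hder (t : ℝ) (ht : 0 < t) : HasDerivAt (fun s => (γ s)⁻¹) (-deriv γ t / γ t ^ 2) t := by
    have hγ := h.hasDerivAt (j := 0) hN ht
    simp only [iteratedDeriv_zero, zero_add, iteratedDeriv_one] at hγ
    exact hγ.fun_inv (h.pos ht).ne'
  have hpow : 0 < (y / x) ^ C₃ 1 := Real.rpow_pos_of_pos (div_pos hy hx) _
  have hle := mul_rpow_le_of_mul_le_deriv (a := -C₃ 1) (fun t ht => inv_pos.2 (h.pos ht))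
    (fun t ht => (hder t ht).differentiableAt.differentiableWithinAt) (fun t ht => by
      have hp := h.pos ht
      have heq : -C₃ 1 * (γ t)⁻¹ * γ t ^ 2 = -(C₃ 1 * γ t) := by field_simp
      rw [(hder t ht).deriv, ← mul_div_assoc, le_div_iff₀ (by positivity), heq]
      linarith [h.mul_deriv_le hN ht]) hx hxy
  rw [Real.rpow_neg (div_pos hy hx).le, ← mul_inv,
    inv_le_inv₀ (mul_pos (h.pos hx) hpow) (h.pos hy)] at hle
  rwa [mul_comm]

theorem gammaR_mem_Icc (h : HypH γ N C₁ C₂ C₃) (hN : 1 ≤ N) (r : ℝ) {t : ℝ}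
    (ht : t ∈ Set.Icc (1 / 2 : ℝ) 2) :
    GammaR γ r t ∈ Set.Icc ((2 : ℝ) ^ C₃ 1)⁻¹ ((2 : ℝ) ^ C₃ 1) := by
  obtain ⟨ht1, ht2⟩ := ht
  have hr : (0 : ℝ) < 2 ^ r := Real.rpow_pos_of_pos two_pos r
  have hK : (0 : ℝ) < 2 ^ C₃ 1 := Real.rpow_pos_of_pos two_pos _
  have hmono := h.2.2.2.2.1.monotoneOn
  have ht0 : 0 < t := by linarith
  constructor
  · rw [GammaR, le_div_iff₀ (h.pos hr), inv_mul_le_iff₀ hK]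
    have h1 := h.le_rpow_mul hN (half_pos hr) (half_le_self hr.le)
    rw [div_div_cancel₀ hr.ne'] at h1
    refine h1.trans (mul_le_mul_of_nonneg_left ?_ hK.le)
    exact hmono (half_pos hr) (mul_pos hr ht0) (by nlinarith)
  · rw [GammaR, div_le_iff₀ (h.pos hr)]
    have h1 := h.le_rpow_mul hN hr (by linarith : (2 : ℝ) ^ r ≤ 2 ^ r * 2)
    rw [mul_div_cancel_left₀ _ hr.ne'] at h1
    exact (hmono (mul_pos hr ht0) (mul_pos hr two_pos) (by nlinarith)).trans h1

theorem hasDerivAt_rescale (h : HypH γ N C₁ C₂ C₃) (r : ℝ) {j : ℕ} (hj : j < N) {t : ℝ}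
    (ht : 0 < t) :
    HasDerivAt (fun t => ((2 : ℝ) ^ r) ^ j * iteratedDeriv j γ (2 ^ r * t) / γ (2 ^ r))
      (((2 : ℝ) ^ r) ^ (j + 1) * iteratedDeriv (j + 1) γ (2 ^ r * t) / γ (2 ^ r)) t := by
  have hr : (0 : ℝ) < 2 ^ r := Real.rpow_pos_of_pos two_pos r
  have h1 := ((h.hasDerivAt hj (mul_pos hr ht)).comp t
    ((hasDerivAt_id t).const_mul ((2 : ℝ) ^ r))).const_mul (((2 : ℝ) ^ r) ^ j)
  exact (h1.div_const (γ (2 ^ r))).congr_deriv (by ring)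

theorem pow_mul_abs_rescale (h : HypH γ N C₁ C₂ C₃) (r : ℝ) (j : ℕ) (t : ℝ) :
    t ^ j * |((2 : ℝ) ^ r) ^ j * iteratedDeriv j γ (2 ^ r * t) / γ (2 ^ r)| =
      ((2 : ℝ) ^ r * t) ^ j * |iteratedDeriv j γ (2 ^ r * t)| / γ (2 ^ r) := by
  have hr : (0 : ℝ) < 2 ^ r := Real.rpow_pos_of_pos two_pos r
  rw [abs_div, abs_mul, abs_of_pos (h.pos hr), abs_of_pos (pow_pos hr j)]
  ring

theorem uniformDerivBound_rescale (h : HypH γ N C₁ C₂ C₃) {m j : ℕ} (h1 : 1 ≤ j)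
    (hj : j + m ≤ N) :
    UniformDerivBound (Set.Ioi 0) (Set.Icc (1 / 2) 2) m
      (fun (r : ℝ) t => ((2 : ℝ) ^ r) ^ j * iteratedDeriv j γ (2 ^ r * t) / γ (2 ^ r)) := by
  have hK : Set.Icc (1 / 2 : ℝ) 2 ⊆ Set.Ioi 0 := fun t ht => one_half_pos.trans_le ht.1
  have bound {j : ℕ} (h1 : 1 ≤ j) (hj : j ≤ N) : ∃ C, ∀ r : ℝ, ∀ t ∈ Set.Icc (1 / 2 : ℝ) 2,
      |((2 : ℝ) ^ r) ^ j * iteratedDeriv j γ (2 ^ r * t) / γ (2 ^ r)| ≤ C := by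
    refine ⟨2 ^ j * (C₃ j * 2 ^ C₃ 1), fun r t ht => ?_⟩
    have hr : (0 : ℝ) < 2 ^ r := Real.rpow_pos_of_pos two_pos r
    have ht0 : 0 < t := hK ht
    have hle : t ^ j * |((2 : ℝ) ^ r) ^ j * iteratedDeriv j γ (2 ^ r * t) / γ (2 ^ r)| ≤
        C₃ j * 2 ^ C₃ 1 := by
      rw [h.pow_mul_abs_rescale r j t]
      calc _ ≤ C₃ j * γ (2 ^ r * t) / γ (2 ^ r) :=
            div_le_div_of_nonneg_right (h.abs_le_mul h1 hj (mul_pos hr ht0)) (h.pos hr).le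
        _ = C₃ j * GammaR γ r t := mul_div_assoc _ _ _
        _ ≤ _ := mul_le_mul_of_nonneg_left (h.gammaR_mem_Icc (by omega) r ht).2
            (h.C₃_pos h1 hj).le
    refine le_trans ?_ (mul_le_mul_of_nonneg_left hle (pow_nonneg zero_le_two j))
    rw [← mul_assoc, ← mul_pow]
    exact le_mul_of_one_le_left (abs_nonneg _) (one_le_pow₀ (by linarith [ht.1]))
  induction m generalizing j with
  | zero => exact bound h1 hj
  | succ m ih =>
    refine ⟨bound h1 (by omega), fun r t ht => (h.hasDerivAt_rescale r (by omega)
      ht).differentiableAt.differentiableWithinAt, ?_⟩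
    exact (ih (j := j + 1) (by omega) (by omega)).congr isOpen_Ioi hK
      fun r t ht => (h.hasDerivAt_rescale r (by omega) ht).deriv

theorem le_abs_rescale_two (h : HypH γ N C₁ C₂ C₃) (hN : 1 ≤ N) (r : ℝ) {t : ℝ}
    (ht : t ∈ Set.Icc (1 / 2 : ℝ) 2) :
    C₂ 2 * (2 ^ C₃ 1)⁻¹ / 4 ≤
      |((2 : ℝ) ^ r) ^ 2 * iteratedDeriv 2 γ (2 ^ r * t) / γ (2 ^ r)| := by
  have hr : (0 : ℝ) < 2 ^ r := Real.rpow_pos_of_pos two_pos r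
  have ht0 : 0 < t := one_half_pos.trans_le ht.1
  rw [div_le_iff₀' four_pos]
  calc C₂ 2 * (2 ^ C₃ 1)⁻¹ ≤ C₂ 2 * GammaR γ r t :=
        mul_le_mul_of_nonneg_left (h.gammaR_mem_Icc hN r ht).1 (h.C₂_pos one_le_two le_rfl).le
    _ = C₂ 2 * γ (2 ^ r * t) / γ (2 ^ r) := (mul_div_assoc _ _ _).symm
    _ ≤ _ := div_le_div_of_nonneg_right (h.mul_le_abs one_le_two le_rfl (mul_pos hr ht0))
        (h.pos hr).le
    _ = _ := (h.pow_mul_abs_rescale r 2 t).symm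
    _ ≤ _ := mul_le_mul_of_nonneg_right (by nlinarith [ht.2]) (abs_nonneg _)

theorem hasDerivAt_deriv_gammaR (h : HypH γ N C₁ C₂ C₃) (hN : 2 ≤ N) (r : ℝ) {t : ℝ}
    (ht : 0 < t) :
    HasDerivAt (deriv (GammaR γ r))
      (((2 : ℝ) ^ r) ^ 2 * iteratedDeriv 2 γ (2 ^ r * t) / γ (2 ^ r)) t := by
  rw [deriv_GammaR]
  simpa using h.hasDerivAt_rescale r (j := 1) hN ht

theorem hasStrictDerivAt_deriv_gammaR (h : HypH γ N C₁ C₂ C₃) (hN : 2 ≤ N) (r : ℝ) {t : ℝ}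
    (ht : 0 < t) : HasStrictDerivAt (deriv (GammaR γ r)) (deriv (deriv (GammaR γ r)) t) t := by
  have hr : (0 : ℝ) < 2 ^ r := Real.rpow_pos_of_pos two_pos r
  have hcd : ContDiffAt ℝ 1 (deriv γ) (2 ^ r * t) :=
    (h.2.1.deriv_of_isOpen isOpen_Ioi (by exact_mod_cast hN)).contDiffAt
      (Ioi_mem_nhds (mul_pos hr ht))
  refine ContDiffAt.hasStrictDerivAt (n := 1) ?_ one_ne_zero
  rw [deriv_GammaR]
  exact (contDiffAt_const.mul (hcd.comp t (contDiffAt_const.mul contDiffAt_id))).div_const _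

theorem injOn_deriv_gammaR (h : HypH γ N C₁ C₂ C₃) (hN : 2 ≤ N) (r : ℝ) :
    Set.InjOn (deriv (GammaR γ r)) (Set.Ioi 0) := by
  have hr : (0 : ℝ) < 2 ^ r := Real.rpow_pos_of_pos two_pos r
  have hinj : Set.InjOn (deriv γ) (Set.Ioi 0) :=
    (h.strictMonoOn_or_strictAntiOn_and_image hN).1.elim StrictMonoOn.injOn StrictAntiOn.injOn
  intro x hx y hy hxy
  simp only [deriv_GammaR, div_left_inj' (h.pos hr).ne'] at hxy
  exact mul_left_cancel₀ hr.ne'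
    (hinj (mul_pos hr hx) (mul_pos hr hy) (mul_left_cancel₀ hr.ne' hxy))

theorem uniformDerivBound_inverseDerivSeq (h : HypH γ N C₁ C₂ C₃) (hN : 2 ≤ N) {k m : ℕ}
    (hkm : k + m + 1 = N) :
    UniformDerivBound (Set.Ioi 0) (Set.Icc (1 / 2) 2) m
      (fun r => inverseDerivSeq (deriv (GammaR γ r)) k) := by
  have hK : Set.Icc (1 / 2 : ℝ) 2 ⊆ Set.Ioi 0 := fun t ht => one_half_pos.trans_le ht.1
  have hc : 0 < C₂ 2 * (2 ^ C₃ 1)⁻¹ / 4 := by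
    have := h.C₂_pos one_le_two le_rfl
    positivity
  refine UniformDerivBound.inverseDerivSeq (n := N - 2) isOpen_Ioi hK
    (Metric.isBounded_Icc _ _) ?_ (by omega)
  refine ((h.uniformDerivBound_rescale one_le_two (m := N - 2) (by omega)).inv isOpen_Ioi hK
    (fun r t ht => ?_) hc fun r t ht => h.le_abs_rescale_two (by omega) r ht).congr isOpen_Ioi hK
    fun r t ht => ?_
  · have hr : (0 : ℝ) < 2 ^ r := Real.rpow_pos_of_pos two_pos r
    exact div_ne_zero (mul_ne_zero (pow_pos hr 2).ne'
      (h.iteratedDeriv_ne_zero one_le_two le_rfl (mul_pos hr ht))) (h.pos hr).ne'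
  · simp only [(h.hasDerivAt_deriv_gammaR hN r ht).deriv]

end HypH

/-- **Lemma 2.1 (v).** For `γ` satisfying (H.) with `N` sufficiently large, `γ'` is strictly
monotone on `(0, ∞)` with `γ' ((0, ∞)) = (0, ∞)`, so `Γ_r'` admits an inverse function
`(Γ_r')⁻¹` on `(0, ∞)`, and `|((Γ_r')⁻¹)^{(k)} (s)| ≤ C` for `0 ≤ k < N` and
`s ∈ Γ_r' ([1/2, 2])`, with `C` independent of `r`. -/
theorem statement11 :
    ∃ N₀ : ℕ, ∀ N : ℕ, N₀ ≤ N →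
    ∀ (γ : ℝ → ℝ) (C₁ : ℝ) (C₂ C₃ : ℕ → ℝ), HypH γ N C₁ C₂ C₃ →
      (StrictMonoOn (deriv γ) (Set.Ioi (0:ℝ)) ∨ StrictAntiOn (deriv γ) (Set.Ioi (0:ℝ))) ∧
      deriv γ '' Set.Ioi (0:ℝ) = Set.Ioi (0:ℝ) ∧
      ∃ C : ℝ, 0 < C ∧ ∀ r : ℝ, ∃ g : ℝ → ℝ,
        (∀ t ∈ Set.Ioi (0:ℝ), g (deriv (GammaR γ r) t) = t) ∧
        (∀ s ∈ deriv (GammaR γ r) '' Set.Ioi (0:ℝ), deriv (GammaR γ r) (g s) = s) ∧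
        (∀ k : ℕ, k < N → ∀ s ∈ deriv (GammaR γ r) '' Set.Icc (1/2 : ℝ) 2,
          |iteratedDeriv k g s| ≤ C) := by
  refine ⟨2, fun N hN γ C₁ C₂ C₃ h => ?_⟩
  obtain ⟨hmono, himage⟩ := h.strictMonoOn_or_strictAntiOn_and_image hN
  refine ⟨hmono, himage, ?_⟩
  have hbound (k : ℕ) : ∃ C, k < N → ∀ r, ∀ t ∈ Set.Icc (1 / 2 : ℝ) 2,
      |inverseDerivSeq (deriv (GammaR γ r)) k t| ≤ C := by
    by_cases hk : k < N
    · obtain ⟨C, hC⟩ := (h.uniformDerivBound_inverseDerivSeq hN (k := k) (m := N - 1 - k)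
        (by omega)).exists_bound
      exact ⟨C, fun _ => hC⟩
    · exact ⟨0, fun hk' => absurd hk' hk⟩
  choose C hC using hbound
  refine ⟨1 + ∑ k ∈ Finset.range N, |C k|, by positivity, fun r => ?_⟩
  have hleft : Set.LeftInvOn (Function.invFunOn (deriv (GammaR γ r)) (Set.Ioi 0))
      (deriv (GammaR γ r)) (Set.Ioi 0) := (h.injOn_deriv_gammaR hN r).leftInvOn_invFunOn
  refine ⟨_, hleft, fun s hs => Function.invFunOn_eq hs, ?_⟩
  rintro k hk _ ⟨t, ht, rfl⟩
  have ht0 : t ∈ Set.Ioi (0 : ℝ) := one_half_pos.trans_le ht.1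
  have hr : (0 : ℝ) < 2 ^ r := Real.rpow_pos_of_pos two_pos r
  rw [iteratedDeriv_leftInvOn (n := N - 1) isOpen_Ioi
    (fun x hx => h.hasStrictDerivAt_deriv_gammaR hN r hx) (fun x hx => ?_) hleft
    (fun j hj => ?_) (by omega) t ht0]
  · calc _ ≤ C k := hC k hk r t ht
      _ ≤ |C k| := le_abs_self _
      _ ≤ ∑ k ∈ Finset.range N, |C k| :=
        Finset.single_le_sum (f := fun k => |C k|) (fun _ _ => abs_nonneg _) (Finset.mem_range.2 hk)
      _ ≤ _ := by linarith
  · rw [(h.hasDerivAt_deriv_gammaR hN r hx).deriv]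
    exact div_ne_zero (mul_ne_zero (pow_pos hr 2).ne'
      (h.iteratedDeriv_ne_zero one_le_two le_rfl (mul_pos hr hx))) (h.pos hr).ne'
  · exact (h.uniformDerivBound_inverseDerivSeq hN (k := j) (m := N - 2 - j + 1)
      (by omega)).2.1 r

end
end

section
/- Let M, m ∈ ℕ with m + 1 ≤ M, let A, B > 0, and let c ∈ C^M(ℝ) be supported in {t ∈ ℝ : |t| ≤ A} and satisfy |c^{(k)}(t)| ≤ B |t|^{2m−k} for all integers 0 ≤ k ≤ M and all t ∈ ℝ. Then there is a constant C, depending only on m, A and B, such that for every λ > 0, |∫_ℝ e^{−iλt²} c(t) dt| ≤ C λ^{−1/2−m}. -/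
open MeasureTheory

/-- The derivative of the quadratic phase `exp (-i λ t²)`. -/
theorem hasDerivAt_exp_quadratic_phase (lam t : ℝ) :
    HasDerivAt (fun t : ℝ => Complex.exp (-(Complex.I) * ((lam * t ^ 2 : ℝ) : ℂ)))
      (Complex.exp (-(Complex.I) * ((lam * t ^ 2 : ℝ) : ℂ)) *
        (-(Complex.I) * (2 * lam * t))) t := by
  have h1 : HasDerivAt (fun t : ℝ => lam * t ^ 2) (lam * (2 * t)) t := by
    simpa using (hasDerivAt_pow 2 t).const_mul lam
  have h2 := (h1.ofReal_comp.const_mul (-(Complex.I))).cexp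
  convert h2 using 2
  push_cast
  ring

theorem norm_exp_quadratic_phase (lam t : ℝ) :
    ‖Complex.exp (-(Complex.I) * ((lam * t ^ 2 : ℝ) : ℂ))‖ = 1 := by
  rw [show -(Complex.I) * ((lam * t ^ 2 : ℝ) : ℂ) = ((-(lam * t ^ 2) : ℝ) : ℂ) * Complex.I by
    push_cast; ring]
  exact Complex.norm_exp_ofReal_mul_I _

theorem continuous_exp_quadratic_phase (lam : ℝ) :
    Continuous fun t : ℝ => Complex.exp (-(Complex.I) * ((lam * t ^ 2 : ℝ) : ℂ)) :=
  continuous_iff_continuousAt.2 fun t => (hasDerivAt_exp_quadratic_phase lam t).continuousAt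

theorem intervalIntegrable_phase_mul_zpow_mul {a R : ℝ} (ha : 0 < a) (haR : a ≤ R) (lam : ℝ)
    (p : ℤ) {g : ℝ → ℂ} (hg : Continuous g) :
    IntervalIntegrable
      (fun t : ℝ => Complex.exp (-(Complex.I) * ((lam * t ^ 2 : ℝ) : ℂ)) * ((t : ℂ) ^ p * g t))
      volume a R := by
  apply ContinuousOn.intervalIntegrable
  refine (continuous_exp_quadratic_phase lam).continuousOn.mul (ContinuousOn.mul ?_ hg.continuousOn)
  refine Complex.continuous_ofReal.continuousOn.zpow₀ p fun t ht => Or.inl ?_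
  rw [Set.uIcc_of_le haR] at ht
  exact_mod_cast (ha.trans_le ht.1).ne'

/-- Integration by parts against the quadratic phase, away from the stationary point. -/
theorem integral_phase_mul_zpow_mul_by_parts {a R : ℝ} (ha : 0 < a) (haR : a ≤ R) (lam : ℝ)
    (p : ℤ) {g g' : ℝ → ℂ} (hg : ∀ t, HasDerivAt g (g' t) t) (hg' : Continuous g')
    (hR : g R = 0) :
    2 * Complex.I * lam *
        (∫ t in a..R, Complex.exp (-(Complex.I) * ((lam * t ^ 2 : ℝ) : ℂ)) * ((t : ℂ) ^ p * g t)) =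
      Complex.exp (-(Complex.I) * ((lam * a ^ 2 : ℝ) : ℂ)) * ((a : ℂ) ^ (p - 1) * g a) +
      ((p - 1 : ℤ) : ℂ) * (∫ t in a..R, Complex.exp (-(Complex.I) * ((lam * t ^ 2 : ℝ) : ℂ)) *
        ((t : ℂ) ^ (p - 2) * g t)) +
      ∫ t in a..R, Complex.exp (-(Complex.I) * ((lam * t ^ 2 : ℝ) : ℂ)) *
        ((t : ℂ) ^ (p - 1) * g' t) := by
  have hgc : Continuous g := continuous_iff_continuousAt.2 fun t => (hg t).continuousAt
  have i0 := intervalIntegrable_phase_mul_zpow_mul ha haR lam p hgc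
  have i1 := intervalIntegrable_phase_mul_zpow_mul ha haR lam (p - 2) hgc
  have i2 := intervalIntegrable_phase_mul_zpow_mul ha haR lam (p - 1) hg'
  have key := intervalIntegral.integral_eq_sub_of_hasDerivAt
    (f := fun t : ℝ => Complex.exp (-(Complex.I) * ((lam * t ^ 2 : ℝ) : ℂ)) *
      ((t : ℂ) ^ (p - 1) * g t)) (a := a) (b := R) (fun t ht => ?_)
    (((i0.const_mul (-(2 * Complex.I * lam))).add (i1.const_mul ((p - 1 : ℤ) : ℂ))).add i2)
  · rw [intervalIntegral.integral_add
        ((i0.const_mul (-(2 * Complex.I * lam))).add (i1.const_mul ((p - 1 : ℤ) : ℂ))) i2,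
      intervalIntegral.integral_add (i0.const_mul (-(2 * Complex.I * lam)))
        (i1.const_mul ((p - 1 : ℤ) : ℂ)),
      intervalIntegral.integral_const_mul, intervalIntegral.integral_const_mul, hR] at key
    linear_combination -key
  · rw [Set.uIcc_of_le haR] at ht
    have ht0 : (t : ℂ) ≠ 0 := by exact_mod_cast (ha.trans_le ht.1).ne'
    have hz : HasDerivAt (fun t : ℝ => (t : ℂ) ^ (p - 1))
        (((p - 1 : ℤ) : ℂ) * (t : ℂ) ^ (p - 1 - 1)) t :=
      (hasDerivAt_zpow (p - 1) (t : ℂ) (Or.inl ht0)).comp_ofReal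
    have h := (hasDerivAt_exp_quadratic_phase lam t).mul (hz.mul (hg t))
    refine h.congr_deriv ?_
    have e : (t : ℂ) ^ p = t ^ (p - 1) * t := by
      rw [← zpow_add_one₀ ht0]; congr 1; ring
    rw [e, show p - 1 - 1 = p - 2 by ring, Pi.mul_apply]
    ring

theorem integral_zpow_le {a R : ℝ} (ha : 0 < a) (haR : a ≤ R) {q : ℤ} (hq : q ≤ -2) :
    ∫ t in a..R, t ^ q ≤ a ^ (q + 1) := by
  have h0 : (0 : ℝ) ∉ Set.uIcc a R := by
    rw [Set.uIcc_of_le haR]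
    exact fun h => ha.not_ge h.1
  rw [integral_zpow (Or.inr ⟨by omega, h0⟩)]
  have hq' : (q : ℝ) ≤ -2 := by exact_mod_cast hq
  have h1 := zpow_pos ha (q + 1)
  have h2 := zpow_pos (ha.trans_le haR) (q + 1)
  rw [div_le_iff_of_neg (by linarith)]
  nlinarith

/-- Repeated integration by parts on `[λ^{-1/2}, R]` for an amplitude that is `O(t ^ s)` together
with the matching derivative bounds; here `a = λ^{-1/2}`. -/
theorem exists_norm_integral_phase_mul_le (n : ℕ) : ∀ p : ℤ, ∃ K : ℝ, 0 ≤ K ∧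
    ∀ (M k : ℕ) (s : ℤ) (B a R : ℝ) (f : ℝ → ℂ), 0 ≤ B → 0 < a → a ≤ R → k + n ≤ M →
      s - k + p - 2 * n ≤ -2 → ContDiff ℝ (M : ℕ∞) f →
      (∀ j : ℕ, j ≤ M → ∀ t : ℝ, 0 < t → ‖iteratedDeriv j f t‖ ≤ B * t ^ (s - j)) →
      (∀ j : ℕ, j ≤ M → iteratedDeriv j f R = 0) →
      ‖∫ t in a..R, Complex.exp (-(Complex.I) * (((a ^ 2)⁻¹ * t ^ 2 : ℝ) : ℂ)) *
        ((t : ℂ) ^ p * iteratedDeriv k f t)‖ ≤ K * B * a ^ (s - k + p + 1) := by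
  induction n with
  | zero =>
    refine fun p => ⟨1, zero_le_one, fun M k s B a R f hB ha haR hk hs hf hbd _ => ?_⟩
    have hq : s - k + p ≤ -2 := by simpa using hs
    have h0 : (0 : ℝ) ∉ Set.uIcc a R := by
      rw [Set.uIcc_of_le haR]
      exact fun h => ha.not_ge h.1
    calc _ ≤ ∫ t in a..R, B * t ^ (s - k + p) := by
          refine intervalIntegral.norm_integral_le_of_norm_le haR (ae_of_all _ fun t ht => ?_)
            ((intervalIntegral.intervalIntegrable_zpow (Or.inr h0)).const_mul B)
          have ht0 : 0 < t := ha.trans ht.1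
          rw [norm_mul, norm_exp_quadratic_phase, one_mul, norm_mul, norm_zpow,
            Complex.norm_real, Real.norm_of_nonneg ht0.le, zpow_add₀ ht0.ne']
          have := mul_le_mul_of_nonneg_left (hbd k (by omega) t ht0) (zpow_pos ht0 p).le
          linarith
      _ ≤ 1 * B * a ^ (s - k + p + 1) := by
          rw [intervalIntegral.integral_const_mul, one_mul]
          exact mul_le_mul_of_nonneg_left (integral_zpow_le ha haR hq) hB
  | succ n ih =>
    intro p
    obtain ⟨K₁, hK₁, h₁⟩ := ih (p - 2)
    obtain ⟨K₂, hK₂, h₂⟩ := ih (p - 1)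
    refine ⟨1 + |((p - 1 : ℤ) : ℝ)| * K₁ + K₂, by positivity,
      fun M k s B a R f hB ha haR hk hs hf hbd hR => ?_⟩
    have b₁ := h₁ M k s B a R f hB ha haR (by omega) (by push_cast at hs; omega) hf hbd hR
    have b₂ := h₂ M (k + 1) s B a R f hB ha haR (by omega) (by push_cast at hs ⊢; omega) hf hbd hR
    have hder : ∀ t, HasDerivAt (iteratedDeriv k f) (iteratedDeriv (k + 1) f t) t := fun t => by
      rw [iteratedDeriv_succ]
      exact ((hf.differentiable_iteratedDeriv k (by exact_mod_cast (by omega : k < M))) t).hasDerivAt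
    have hcont : Continuous (iteratedDeriv (k + 1) f) :=
      hf.continuous_iteratedDeriv (k + 1) (by exact_mod_cast (by omega : k + 1 ≤ M))
    have parts := integral_phase_mul_zpow_mul_by_parts ha haR (a ^ 2)⁻¹ p hder hcont
      (hR k (by omega))
    have hn := congrArg norm parts
    rw [norm_mul, norm_mul, norm_mul, Complex.norm_I, Complex.norm_real,
      Real.norm_of_nonneg (by positivity : (0 : ℝ) ≤ (a ^ 2)⁻¹)] at hn
    have b₀ : ‖Complex.exp (-(Complex.I) * (((a ^ 2)⁻¹ * a ^ 2 : ℝ) : ℂ)) *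
        ((a : ℂ) ^ (p - 1) * iteratedDeriv k f a)‖ ≤ B * a ^ (s - k + p - 1) := by
      rw [norm_mul, norm_exp_quadratic_phase, one_mul, norm_mul, norm_zpow,
        Complex.norm_real, Real.norm_of_nonneg ha.le,
        show s - k + p - 1 = (p - 1) + (s - k) by ring, zpow_add₀ ha.ne']
      have := mul_le_mul_of_nonneg_left (hbd k (by omega) a ha) (zpow_pos ha (p - 1)).le
      linarith
    rw [show s - k + (p - 2) + 1 = s - k + p - 1 by ring] at b₁
    rw [show s - ((k + 1 : ℕ) : ℤ) + (p - 1) + 1 = s - k + p - 1 by push_cast; ring] at b₂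
    have b₁' := mul_le_mul_of_nonneg_left b₁ (abs_nonneg ((p - 1 : ℤ) : ℝ))
    have tri := norm_add₃_le (a := Complex.exp (-(Complex.I) * (((a ^ 2)⁻¹ * a ^ 2 : ℝ) : ℂ)) *
        ((a : ℂ) ^ (p - 1) * iteratedDeriv k f a))
      (b := ((p - 1 : ℤ) : ℂ) * (∫ t in a..R,
        Complex.exp (-(Complex.I) * (((a ^ 2)⁻¹ * t ^ 2 : ℝ) : ℂ)) *
        ((t : ℂ) ^ (p - 2) * iteratedDeriv k f t)))
      (c := ∫ t in a..R, Complex.exp (-(Complex.I) * (((a ^ 2)⁻¹ * t ^ 2 : ℝ) : ℂ)) *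
        ((t : ℂ) ^ (p - 1) * iteratedDeriv (k + 1) f t))
    rw [← hn, norm_mul ((p - 1 : ℤ) : ℂ), Complex.norm_intCast] at tri
    set X := ‖∫ t in a..R, Complex.exp (-(Complex.I) * (((a ^ 2)⁻¹ * t ^ 2 : ℝ) : ℂ)) *
        ((t : ℂ) ^ p * iteratedDeriv k f t)‖
    have hX : 2 * (a ^ 2)⁻¹ * X ≤
        (1 + |((p - 1 : ℤ) : ℝ)| * K₁ + K₂) * B * a ^ (s - k + p - 1) := by
      have h2 : ‖(2 : ℂ)‖ = 2 := by simp
      rw [h2, mul_one] at tri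
      linarith
    have hX0 : 0 ≤ X := norm_nonneg _
    rw [show s - k + p + 1 = (s - k + p - 1) + 2 by ring, zpow_add₀ ha.ne', zpow_ofNat]
    have := mul_le_mul_of_nonneg_right hX (sq_nonneg a)
    have e : 2 * (a ^ 2)⁻¹ * X * a ^ 2 = 2 * X := by field_simp
    rw [e] at this
    linarith

/-- All derivatives of a function supported in `[-A, A]` vanish to the right of `A`. -/
theorem iteratedDeriv_eq_zero_of_lt {c : ℝ → ℂ} {A R : ℝ} (hc : ∀ t : ℝ, c t ≠ 0 → |t| ≤ A)
    (hR : A < R) (j : ℕ) : iteratedDeriv j c R = 0 := by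
  have h : c =ᶠ[nhds R] fun _ => 0 := by
    filter_upwards [lt_mem_nhds hR] with t ht
    by_contra h
    exact (ht.trans_le (le_abs_self t)).not_ge (hc t h)
  rw [h.iteratedDeriv_eq]
  simp

/-- **Lemma 2.2 (van der Corput with degenerate amplitude).** If `c ∈ C^M (ℝ)` is supported
in `{|t| ≤ A}` and satisfies `|c^{(k)} (t)| ≤ B |t|^{2m - k}` for all `k ≤ M`, where
`m + 1 ≤ M`, then `|∫ e^{-iλt²} c (t) dt| ≤ C λ^{-1/2 - m}` for all `λ > 0`, with `C`
depending only on `m`, `A` and `B`. -/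
theorem statement12 (m : ℕ) (A B : ℝ) (hA : 0 < A) (hB : 0 < B) :
    ∃ C : ℝ, 0 < C ∧
      ∀ M : ℕ, m + 1 ≤ M →
      ∀ c : ℝ → ℂ, ContDiff ℝ (M : ℕ∞) c →
        (∀ t : ℝ, c t ≠ 0 → |t| ≤ A) →
        (∀ k : ℕ, k ≤ M → ∀ t : ℝ,
          ‖iteratedDeriv k c t‖ ≤ B * |t| ^ ((2 * (m : ℤ) - (k : ℤ) : ℤ) : ℝ)) →
        ∀ lam : ℝ, 0 < lam →
          ‖∫ t : ℝ, Complex.exp (-(Complex.I) * ((lam * t ^ 2 : ℝ) : ℂ)) * c t‖ ≤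
            C * lam ^ (-(1/2 : ℝ) - m) := by
  obtain ⟨K, hK, h⟩ := exists_norm_integral_phase_mul_le (m + 1) 0
  refine ⟨2 * B + 2 * (K * B), by positivity, fun M hM c hc hsupp hbd lam hlam => ?_⟩
  obtain ⟨a, ha, hlam_eq, hpow⟩ : ∃ a : ℝ, 0 < a ∧ lam = (a ^ 2)⁻¹ ∧
      lam ^ (-(1/2 : ℝ) - m) = a ^ (2 * m + 1) := by
    refine ⟨lam ^ (-(1/2 : ℝ)), Real.rpow_pos_of_pos hlam _, ?_, ?_⟩
    · rw [← Real.rpow_natCast, ← Real.rpow_mul hlam.le, ← Real.rpow_neg hlam.le]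
      norm_num
    · rw [← Real.rpow_natCast, ← Real.rpow_mul hlam.le]
      congr 1
      push_cast
      ring
  rw [hpow, hlam_eq]
  set R := max A a + 1 with hRdef
  have hAR : A < R := by linarith [le_max_left A a]
  have haR : a ≤ R := by linarith [le_max_right A a]
  have hneg : ∀ t : ℝ, c (-t) ≠ 0 → |t| ≤ A := fun t ht => by simpa using hsupp (-t) ht
  have hs : (2 * (m : ℤ)) - ((0 : ℕ) : ℤ) + 0 - 2 * ((m + 1 : ℕ) : ℤ) ≤ -2 := by
    push_cast; omega
  have hb : ∀ j : ℕ, j ≤ M → ∀ t : ℝ, t ≠ 0 →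
      ‖iteratedDeriv j c t‖ ≤ B * |t| ^ (2 * (m : ℤ) - j) := fun j hj t _ => by
    simpa only [Real.rpow_intCast] using hbd j hj t
  have right := h M 0 (2 * m) B a R c hB.le ha haR (by omega) hs hc
    (fun j hj t ht => by simpa only [abs_of_pos ht] using hb j hj t ht.ne')
    (fun j _ => iteratedDeriv_eq_zero_of_lt hsupp hAR j)
  have left := h M 0 (2 * m) B a R (fun t => c (-t)) hB.le ha haR (by omega) hs
    (hc.comp contDiff_neg)
    (fun j hj t ht => by
      rw [iteratedDeriv_comp_neg, norm_smul]
      simpa [abs_of_pos ht] using hb j hj (-t) (neg_ne_zero.2 ht.ne'))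
    (fun j _ => iteratedDeriv_eq_zero_of_lt hneg hAR j)
  have hexp : (2 * (m : ℤ)) - ((0 : ℕ) : ℤ) + 0 + 1 = ((2 * m + 1 : ℕ) : ℤ) := by
    push_cast; ring
  simp only [iteratedDeriv_zero, zpow_zero, one_mul] at right left
  rw [hexp, zpow_natCast] at right left
  set F : ℝ → ℂ := fun t => Complex.exp (-(Complex.I) * (((a ^ 2)⁻¹ * t ^ 2 : ℝ) : ℂ)) * c t
    with hF
  have hFc : Continuous F := (continuous_exp_quadratic_phase _).mul hc.continuous
  have hleft : ∫ t in a..R, Complex.exp (-(Complex.I) * (((a ^ 2)⁻¹ * t ^ 2 : ℝ) : ℂ)) * c (-t) =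
      ∫ t in (-R)..(-a), F t := by
    rw [← intervalIntegral.integral_comp_neg]
    simp [hF]
  have middle : ‖∫ t in (-a)..a, F t‖ ≤ 2 * B * a ^ (2 * m + 1) := by
    have := intervalIntegral.norm_integral_le_of_norm_le_const (f := F) (a := -a) (b := a)
      (C := B * a ^ (2 * m)) fun t ht => by
        rw [Set.uIoc_of_le (by linarith)] at ht
        have h0 := hbd 0 (Nat.zero_le _) t
        rw [Real.rpow_intCast, iteratedDeriv_zero,
          show (2 * (m : ℤ)) - ((0 : ℕ) : ℤ) = ((2 * m : ℕ) : ℤ) by push_cast; ring,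
          zpow_natCast] at h0
        rw [hF, norm_mul, norm_exp_quadratic_phase, one_mul]
        refine h0.trans ?_
        gcongr
        exact abs_le.2 ⟨ht.1.le, ht.2⟩
    refine this.trans_eq ?_
    rw [show a - -a = 2 * a by ring, abs_of_pos (by positivity)]
    ring
  have whole : ∫ t, F t = (∫ t in (-R)..(-a), F t) + (∫ t in (-a)..a, F t) + ∫ t in a..R, F t := by
    rw [intervalIntegral.integral_add_adjacent_intervals (hFc.intervalIntegrable _ _)
        (hFc.intervalIntegrable _ _),
      intervalIntegral.integral_add_adjacent_intervals (hFc.intervalIntegrable _ _)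
        (hFc.intervalIntegrable _ _)]
    refine (intervalIntegral.integral_eq_integral_of_support_subset fun t ht => ?_).symm
    have := abs_le.1 (hsupp t (right_ne_zero_of_mul ht))
    exact ⟨by linarith, by linarith⟩
  rw [hleft] at left
  rw [whole]
  have tri := norm_add₃_le (a := ∫ t in (-R)..(-a), F t) (b := ∫ t in (-a)..a, F t)
    (c := ∫ t in a..R, F t)
  linarith
end

section
/- Let γ: (0,∞) → (0,∞) be twice continuously differentiable with γ' > 0 on (0,∞), and suppose there are positive constants C₂^{(1)}, C₃^{(1)}, C₂^{(2)}, C₃^{(2)} such that for all t > 0, C₂^{(1)} ≤ t γ'(t)/γ(t) ≤ C₃^{(1)} and C₂^{(2)} ≤ |t² γ''(t)/γ(t)| ≤ C₃^{(2)}. Then exactly one of the following holds: either e^{C₂^{(2)}/(2 C₃^{(1)})} ≤ γ'(2t)/γ'(t) ≤ e^{C₃^{(2)}/C₂^{(1)}} for all t > 0, or e^{−C₃^{(2)}/C₂^{(1)}} ≤ γ'(2t)/γ'(t) ≤ e^{−C₂^{(2)}/(2 C₃^{(1)})} for all t > 0. -/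
/-- If `a ≤ t f' (t) ≤ b` on `(0, ∞)` with `0 ≤ a`, then `a / 2 ≤ f (2t) - f t ≤ b`. -/
theorem sub_mem_Icc_of_mul_deriv_mem_Icc {f f' : ℝ → ℝ} {a b : ℝ} (ha : 0 ≤ a)
    (hf : ∀ t, 0 < t → HasDerivAt f (f' t) t)
    (hab : ∀ t, 0 < t → t * f' t ∈ Set.Icc a b) {t : ℝ} (ht : 0 < t) :
    f (2 * t) - f t ∈ Set.Icc (a / 2) b := by
  obtain ⟨c, ⟨htc, hct⟩, hc⟩ := exists_hasDerivAt_eq_slope f f' (by linarith : t < 2 * t)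
    (fun x hx => (hf x (ht.trans_le hx.1)).continuousAt.continuousWithinAt)
    (fun x hx => hf x (ht.trans hx.1))
  have hc0 : 0 < c := ht.trans htc
  obtain ⟨h1, h2⟩ := hab c hc0
  have hslope : f (2 * t) - f t = t * f' c := by
    rw [hc]
    field_simp
    ring
  have hf'c : 0 ≤ f' c := nonneg_of_mul_nonneg_right (ha.trans h1) hc0
  rw [hslope]
  constructor <;> nlinarith

/-- A continuous nonvanishing real function on a preconnected set has constant sign. -/
theorem IsPreconnected.forall_pos_or_forall_neg {X : Type*} [TopologicalSpace X] {s : Set X}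
    (hs : IsPreconnected s) {f : X → ℝ} (hf : ContinuousOn f s) (h0 : ∀ x ∈ s, f x ≠ 0) :
    (∀ x ∈ s, 0 < f x) ∨ ∀ x ∈ s, f x < 0 := by
  by_contra! h
  obtain ⟨⟨x, hx, hfx⟩, y, hy, hfy⟩ := h
  obtain ⟨z, hz, hfz⟩ := hs.intermediate_value hx hy hf ⟨hfx, hfy⟩
  exact h0 z hz hfz

/-- **Doubling property (1.6).** If `γ : (0, ∞) → (0, ∞)` is twice continuously
differentiable with `γ' > 0`, `C₂⁽¹⁾ ≤ t γ' (t) / γ (t) ≤ C₃⁽¹⁾` and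
`C₂⁽²⁾ ≤ |t² γ'' (t) / γ (t)| ≤ C₃⁽²⁾` for all `t > 0`, then exactly one of the following
holds: either `e^{C₂⁽²⁾/(2C₃⁽¹⁾)} ≤ γ' (2t) / γ' (t) ≤ e^{C₃⁽²⁾/C₂⁽¹⁾}` for all `t > 0`, or
`e^{-C₃⁽²⁾/C₂⁽¹⁾} ≤ γ' (2t) / γ' (t) ≤ e^{-C₂⁽²⁾/(2C₃⁽¹⁾)}` for all `t > 0`. -/
theorem statement15 (γ : ℝ → ℝ) (C₂₁ C₃₁ C₂₂ C₃₂ : ℝ)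
    (hC₂₁ : 0 < C₂₁) (hC₃₁ : 0 < C₃₁) (hC₂₂ : 0 < C₂₂) (hC₃₂ : 0 < C₃₂)
    (hpos : ∀ t : ℝ, 0 < t → 0 < γ t)
    (hpos' : ∀ t : ℝ, 0 < t → 0 < deriv γ t)
    (hsmooth : ContDiffOn ℝ 2 γ (Set.Ioi (0:ℝ)))
    (hbd1 : ∀ t : ℝ, 0 < t →
      C₂₁ ≤ t * deriv γ t / γ t ∧ t * deriv γ t / γ t ≤ C₃₁)
    (hbd2 : ∀ t : ℝ, 0 < t →
      C₂₂ ≤ |t ^ 2 * iteratedDeriv 2 γ t / γ t| ∧ |t ^ 2 * iteratedDeriv 2 γ t / γ t| ≤ C₃₂) :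
    Xor'
      (∀ t : ℝ, 0 < t →
        Real.exp (C₂₂ / (2 * C₃₁)) ≤ deriv γ (2 * t) / deriv γ t ∧
          deriv γ (2 * t) / deriv γ t ≤ Real.exp (C₃₂ / C₂₁))
      (∀ t : ℝ, 0 < t →
        Real.exp (-(C₃₂ / C₂₁)) ≤ deriv γ (2 * t) / deriv γ t ∧
          deriv γ (2 * t) / deriv γ t ≤ Real.exp (-(C₂₂ / (2 * C₃₁)))) := by
  have hdiff : ContDiffOn ℝ 1 (deriv γ) (Set.Ioi 0) :=
    hsmooth.deriv_of_isOpen isOpen_Ioi (by norm_num)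
  have hcont : ContinuousOn (iteratedDeriv 2 γ) (Set.Ioi 0) := by
    rw [iteratedDeriv_succ, iteratedDeriv_one]
    exact hdiff.continuousOn_deriv_of_isOpen isOpen_Ioi le_rfl
  have hlog : ∀ t, 0 < t →
      HasDerivAt (fun x => Real.log (deriv γ x)) (iteratedDeriv 2 γ t / deriv γ t) t := by
    intro t ht
    have h : HasDerivAt (deriv γ) (iteratedDeriv 2 γ t) t := by
      rw [iteratedDeriv_succ, iteratedDeriv_one]
      exact ((hdiff.differentiableOn one_ne_zero).differentiableAt (Ioi_mem_nhds ht)).hasDerivAt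
    exact h.log (hpos' t ht).ne'
  have habs : ∀ t, 0 < t →
      |t * (iteratedDeriv 2 γ t / deriv γ t)| ∈ Set.Icc (C₂₂ / C₃₁) (C₃₂ / C₂₁) := by
    intro t ht
    have hg := hpos t ht
    have hg' := hpos' t ht
    have hq : 0 < t * deriv γ t / γ t := by positivity
    have h : t * (iteratedDeriv 2 γ t / deriv γ t) =
        t ^ 2 * iteratedDeriv 2 γ t / γ t / (t * deriv γ t / γ t) := by
      field_simp
    rw [h, abs_div, abs_of_pos hq]
    obtain ⟨h1, h2⟩ := hbd1 t ht
    obtain ⟨h3, h4⟩ := hbd2 t ht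
    exact ⟨div_le_div₀ (abs_nonneg _) h3 hq h2, div_le_div₀ hC₃₂.le h4 hC₂₁ h1⟩
  have hne : ∀ t ∈ Set.Ioi (0 : ℝ), iteratedDeriv 2 γ t ≠ 0 := by
    intro t ht h
    have h1 := (hbd2 t ht).1
    simp only [h, mul_zero, zero_div, abs_zero] at h1
    linarith
  have hratio : ∀ t, 0 < t → deriv γ (2 * t) / deriv γ t =
      Real.exp (Real.log (deriv γ (2 * t)) - Real.log (deriv γ t)) := by
    intro t ht
    rw [Real.exp_sub, Real.exp_log (hpos' _ (by positivity)), Real.exp_log (hpos' t ht)]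
  have ha : 0 < C₂₂ / C₃₁ := by positivity
  have hhalf : C₂₂ / (2 * C₃₁) = C₂₂ / C₃₁ / 2 := by
    field_simp
  rw [hhalf]
  refine (xor_iff_or_and_not_and _ _).mpr ⟨?_, fun ⟨h1, h2⟩ => ?_⟩
  · refine (isPreconnected_Ioi.forall_pos_or_forall_neg hcont hne).imp ?_ ?_
    · intro hsign t ht
      have hmem := sub_mem_Icc_of_mul_deriv_mem_Icc ha.le hlog (fun x hx => by
        have h := habs x hx
        rwa [abs_of_pos (mul_pos hx (div_pos (hsign x hx) (hpos' x hx)))] at h) ht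
      rw [hratio t ht, Real.exp_le_exp, Real.exp_le_exp]
      exact hmem
    · intro hsign t ht
      have hmem := sub_mem_Icc_of_mul_deriv_mem_Icc ha.le (fun x hx => (hlog x hx).neg)
        (fun x hx => by
          have h := habs x hx
          rwa [abs_of_neg (mul_neg_of_pos_of_neg hx
            (div_neg_of_neg_of_pos (hsign x hx) (hpos' x hx))), ← mul_neg] at h) ht
      simp only [Pi.neg_apply, Set.mem_Icc] at hmem
      rw [hratio t ht, Real.exp_le_exp, Real.exp_le_exp]
      constructor <;> linarith [hmem.1, hmem.2]
  · have h := Real.exp_le_exp.mp ((h1 1 one_pos).1.trans (h2 1 one_pos).2)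
    linarith
end
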